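/- Completeness of the disjunction fragment with respect to the two-element algebra: for all Γ ∪ {φ} ⊆ 𝔉_{{∨}} (formulas built from letters using only ∨), Γ ⊢_{{∨}} φ if and only if Γ ⊨_𝟐 φ, where 𝟐 is the two-element algebra {0,1} with the usual join and designated set D = {1}. -/

import Mathlib

/-- The four propositional connectives. -/
inductive Conn : Type
  | conj | disj | impl | nega
deriving DecidableEq

/-- Propositional formulas over countably many letters `p₀, p₁, …`. -/
inductive PropForm : Type
  | var : ℕ → PropForm
  | and : PropForm → PropForm → PropForm
  | or : PropForm → PropForm → PropForm
  | imp : PropForm → PropForm → PropForm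
  | neg : PropForm → PropForm

/-- The set of connectives occurring in a formula. -/
def PropForm.conns : PropForm → Set Conn
  | .var _ => ∅
  | .and a b => insert .conj (a.conns ∪ b.conns)
  | .or a b => insert .disj (a.conns ∪ b.conns)
  | .imp a b => insert .impl (a.conns ∪ b.conns)
  | .neg a => insert .nega a.conns

/-- `φ ∈ 𝔉_F` : the formula `φ` uses only connectives belonging to the fragment `F`. -/
def InFrag (F : Set Conn) (φ : PropForm) : Prop := φ.conns ⊆ F

/-- Derivability `Γ ⊢_F φ` for the fragment `F`: the least relation closed under
membership, monotonicity, cut, and the two directions of the rules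
(R∧), (R∨), (R→), (R¬I), (R¬E) for the connectives in `F`. -/
inductive Deriv (F : Set Conn) : Set PropForm → PropForm → Prop
  | mem {Γ : Set PropForm} {φ : PropForm} : φ ∈ Γ → Deriv F Γ φ
  | mono {Γ : Set PropForm} {φ ψ : PropForm} : Deriv F Γ φ → Deriv F (insert ψ Γ) φ
  | cut {Γ Δ : Set PropForm} {φ ψ : PropForm} :
      Deriv F Γ φ → Deriv F (insert φ Δ) ψ → Deriv F (Γ ∪ Δ) ψ
  | andI {Γ : Set PropForm} {φ ψ : PropForm} :
      Conn.conj ∈ F → Deriv F Γ φ → Deriv F Γ ψ → Deriv F Γ (.and φ ψ)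
  | andE1 {Γ : Set PropForm} {φ ψ : PropForm} :
      Conn.conj ∈ F → Deriv F Γ (.and φ ψ) → Deriv F Γ φ
  | andE2 {Γ : Set PropForm} {φ ψ : PropForm} :
      Conn.conj ∈ F → Deriv F Γ (.and φ ψ) → Deriv F Γ ψ
  | orI {Γ : Set PropForm} {φ ψ χ : PropForm} :
      Conn.disj ∈ F → Deriv F (insert φ Γ) χ → Deriv F (insert ψ Γ) χ →
      Deriv F (insert (.or φ ψ) Γ) χ
  | orE1 {Γ : Set PropForm} {φ ψ χ : PropForm} :
      Conn.disj ∈ F → Deriv F (insert (.or φ ψ) Γ) χ → Deriv F (insert φ Γ) χ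
  | orE2 {Γ : Set PropForm} {φ ψ χ : PropForm} :
      Conn.disj ∈ F → Deriv F (insert (.or φ ψ) Γ) χ → Deriv F (insert ψ Γ) χ
  | impI {Γ : Set PropForm} {φ ψ : PropForm} :
      Conn.impl ∈ F → Deriv F (insert φ Γ) ψ → Deriv F Γ (.imp φ ψ)
  | impE {Γ : Set PropForm} {φ ψ : PropForm} :
      Conn.impl ∈ F → Deriv F Γ (.imp φ ψ) → Deriv F (insert φ Γ) ψ
  | negI {Γ : Set PropForm} {φ ψ : PropForm} :
      Conn.nega ∈ F → Deriv F (insert φ Γ) ψ → Deriv F (insert φ Γ) (.neg ψ) →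
      Deriv F Γ (.neg φ)
  | negE {Γ : Set PropForm} {φ ψ : PropForm} :
      Conn.nega ∈ F → Deriv F Γ φ → Deriv F Γ (.neg φ) → Deriv F Γ ψ

/-- An algebra interpreting the connectives on a carrier `V`. -/
structure Alg (V : Type) where
  and : V → V → V
  or : V → V → V
  imp : V → V → V
  neg : V → V

/-- The homomorphic extension of an assignment `v` of letters. -/
def Alg.eval {V : Type} (A : Alg V) (v : ℕ → V) : PropForm → V
  | .var n => v n
  | .and a b => A.and (A.eval v a) (A.eval v b)
  | .or a b => A.or (A.eval v a) (A.eval v b)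
  | .imp a b => A.imp (A.eval v a) (A.eval v b)
  | .neg a => A.neg (A.eval v a)

/-- Semantic consequence `Γ ⊨_{A,D} φ`. -/
def SemConseq {V : Type} (A : Alg V) (D : Set V) (Γ : Set PropForm) (φ : PropForm) : Prop :=
  ∀ v : ℕ → V, (∀ ψ ∈ Γ, A.eval v ψ ∈ D) → A.eval v φ ∈ D

/-- The fragment `F` has a finite semantics. -/
def HasFiniteSemantics (F : Set Conn) : Prop :=
  ∃ (V : Type) (_ : Fintype V) (A : Alg V) (D : Set V),
    ∀ (Γ : Set PropForm) (φ : PropForm),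
      (∀ ψ ∈ Γ, InFrag F ψ) → InFrag F φ →
      (Deriv F Γ φ ↔ SemConseq A D Γ φ)

/-- `φ ∨̇ ψ = (φ → ψ) → ψ`. -/
def dvee (a b : PropForm) : PropForm := .imp (.imp a b) b

/-- Left-associated iterated `∨̇` of a list of formulas. -/
def bigDvee : List PropForm → PropForm
  | [] => .var 0
  | a :: rest => rest.foldl dvee a

/-- Left-associated iterated `∨` of a list of formulas. -/
def bigOrF : List PropForm → PropForm
  | [] => .var 0
  | a :: rest => rest.foldl PropForm.or a

/-- All pairs `(i, j)` with `1 ≤ i < j ≤ n+1`. -/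
def pairs (n : ℕ) : List (ℕ × ℕ) :=
  (List.range' 2 n).flatMap fun j => (List.range' 1 (j - 1)).map fun i => (i, j)

/-- `α_n = ∨̇_{1 ≤ i < j ≤ n+1} (p_j → p_i)`. -/
def alphaImp (n : ℕ) : PropForm :=
  bigDvee ((pairs n).map fun p => .imp (.var p.2) (.var p.1))

/-- `α_n = ⋁_{1 ≤ i < j ≤ n+1} ¬¬(¬p_i ∨ p_j)`. -/
def alphaOrNeg (n : ℕ) : PropForm :=
  bigOrF ((pairs n).map fun p => .neg (.neg (.or (.neg (.var p.1)) (.var p.2))))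

/-- Two-valued Boolean evaluation. -/
def evalBool (v : ℕ → Bool) : PropForm → Bool
  | .var n => v n
  | .and a b => evalBool v a && evalBool v b
  | .or a b => evalBool v a || evalBool v b
  | .imp a b => !evalBool v a || evalBool v b
  | .neg a => !evalBool v a

/-- Classical (two-valued) consequence `Γ ⊢_c φ`. -/
def ClassConseq (Γ : Set PropForm) (φ : PropForm) : Prop :=
  ∀ v : ℕ → Bool, (∀ ψ ∈ Γ, evalBool v ψ = true) → evalBool v φ = true

/-- The two-element Boolean algebra `𝟐`. -/
def alg2 : Alg Bool where
  and a b := a && b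
  or a b := a || b
  imp a b := !a || b
  neg a := !a

/-- The three-element algebra `𝟑` on the chain `0 < 1/2 < 1` (coded as `0 < 1 < 2` in `Fin 3`),
with meet `min` and meet complement `¬0 = 1`, `¬(1/2) = ¬1 = 0` (its `or`/`imp` are those of the
3-element Heyting chain). -/
def alg3 : Alg (Fin 3) where
  and a b := min a b
  or a b := max a b
  imp a b := if a ≤ b then 2 else b
  neg a := if a = 0 then 2 else 0

/-- The `(n+1)`-element Heyting chain, coded on `Fin (n+1)` (so `k` codes the element `k+1`). -/
def chainAlg (n : ℕ) : Alg (Fin (n + 1)) where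
  and a b := min a b
  or a b := max a b
  imp a b := if a ≤ b then Fin.last n else b
  neg a := if a = 0 then Fin.last n else 0

theorem inFrag_or {F : Set Conn} {a b : PropForm} (h : InFrag F (.or a b)) :
    InFrag F a ∧ InFrag F b :=
  ⟨fun _ hc => h (Set.mem_insert_of_mem _ (Or.inl hc)),
    fun _ hc => h (Set.mem_insert_of_mem _ (Or.inr hc))⟩

/-- Every derivation in the disjunction fragment is sound for the two-element algebra. -/
theorem Deriv.semConseq_alg2 {Γ : Set PropForm} {φ : PropForm}
    (h : Deriv {Conn.disj} Γ φ) : SemConseq alg2 {true} Γ φ := by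
  induction h with
  | mem h => exact fun v hv => hv _ h
  | mono _ ih => exact fun v hv => ih v fun χ hχ => hv χ (Set.mem_insert_of_mem _ hχ)
  | cut _ _ ih₁ ih₂ =>
    intro v hv
    refine ih₂ v (Set.forall_mem_insert.2 ⟨ih₁ v fun χ hχ => hv χ (Or.inl hχ), ?_⟩)
    exact fun χ hχ => hv χ (Or.inr hχ)
  | orI _ _ _ ih₁ ih₂ =>
    intro v hv
    obtain ⟨h_or, hΓ⟩ := Set.forall_mem_insert.1 hv
    rcases Bool.or_eq_true_iff.1 h_or with h | h
    · exact ih₁ v (Set.forall_mem_insert.2 ⟨h, hΓ⟩)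
    · exact ih₂ v (Set.forall_mem_insert.2 ⟨h, hΓ⟩)
  | orE1 _ _ ih =>
    intro v hv
    obtain ⟨h, hΓ⟩ := Set.forall_mem_insert.1 hv
    exact ih v (Set.forall_mem_insert.2 ⟨Bool.or_eq_true_iff.2 (Or.inl h), hΓ⟩)
  | orE2 _ _ ih =>
    intro v hv
    obtain ⟨h, hΓ⟩ := Set.forall_mem_insert.1 hv
    exact ih v (Set.forall_mem_insert.2 ⟨Bool.or_eq_true_iff.2 (Or.inr h), hΓ⟩)
  | andI h | andE1 h | andE2 h | impI h | impE h | negI h | negE h => cases h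

theorem Deriv.trans_singleton {F : Set Conn} {Γ : Set PropForm} {φ ψ : PropForm}
    (h₁ : Deriv F Γ ψ) (h₂ : Deriv F {ψ} φ) : Deriv F Γ φ := by
  have h₃ : Deriv F (insert ψ ∅) φ := by simpa using h₂
  simpa using h₁.cut h₃

theorem Deriv.or_left {F : Set Conn} (hF : Conn.disj ∈ F) (a b : PropForm) :
    Deriv F {a} (.or a b) := by
  have h : Deriv F (insert a ∅) (.or a b) := .orE1 hF (.mem (Set.mem_insert _ _))
  simpa using h

theorem Deriv.or_right {F : Set Conn} (hF : Conn.disj ∈ F) (a b : PropForm) :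
    Deriv F {b} (.or a b) := by
  have h : Deriv F (insert b ∅) (.or a b) := .orE2 hF (.mem (Set.mem_insert _ _))
  simpa using h

theorem Deriv.or_elim {F : Set Conn} (hF : Conn.disj ∈ F) {a b φ : PropForm}
    (ha : Deriv F {a} φ) (hb : Deriv F {b} φ) : Deriv F {.or a b} φ := by
  have h : Deriv F (insert (.or a b) ∅) φ :=
    .orI hF (by simpa using ha) (by simpa using hb)
  simpa using h

/-- A disjunctive formula is false once all letters that derive it are false. -/
theorem eval_alg2_eq_false {v : ℕ → Bool} {φ : PropForm} (hφ : InFrag {Conn.disj} φ)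
    (hv : ∀ n, Deriv {Conn.disj} {.var n} φ → v n = false) : alg2.eval v φ = false := by
  induction φ with
  | var n => exact hv n (.mem rfl)
  | or a b iha ihb =>
    obtain ⟨ha, hb⟩ := inFrag_or hφ
    exact Bool.or_eq_false_iff.2
      ⟨iha ha fun n h => hv n (h.trans_singleton (.or_left (Set.mem_singleton _) a b)),
        ihb hb fun n h => hv n (h.trans_singleton (.or_right (Set.mem_singleton _) a b))⟩
  | and | imp | neg => cases hφ (Set.mem_insert _ _)

/-- A false disjunctive formula derives `φ` if all false letters do. -/
theorem deriv_of_eval_alg2_eq_false {v : ℕ → Bool} {φ ψ : PropForm}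
    (hψ : InFrag {Conn.disj} ψ) (hv : ∀ n, v n = false → Deriv {Conn.disj} {.var n} φ)
    (h : alg2.eval v ψ = false) : Deriv {Conn.disj} {ψ} φ := by
  induction ψ with
  | var n => exact hv n h
  | or a b iha ihb =>
    obtain ⟨ha, hb⟩ := inFrag_or hψ
    obtain ⟨h₁, h₂⟩ := Bool.or_eq_false_iff.1 h
    exact .or_elim (Set.mem_singleton _) (iha ha h₁) (ihb hb h₂)
  | and | imp | neg => cases hψ (Set.mem_insert _ _)

/-- completeness of the `{∨}`-fragment w.r.t. the two-element algebra
`𝟐` with designated set `{1}` (`true`). -/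
theorem disj_fragment_two_valued (Γ : Set PropForm) (φ : PropForm)
    (hΓ : ∀ ψ ∈ Γ, InFrag {Conn.disj} ψ) (hφ : InFrag {Conn.disj} φ) :
    Deriv {Conn.disj} Γ φ ↔ SemConseq alg2 {true} Γ φ := by
  classical
  refine ⟨Deriv.semConseq_alg2, fun h => ?_⟩
  let v : ℕ → Bool := fun n => !decide (Deriv {Conn.disj} {.var n} φ)
  have hv : ∀ n, v n = false ↔ Deriv {Conn.disj} {.var n} φ := fun n => by simp [v]
  have h_false := eval_alg2_eq_false hφ fun n => (hv n).2
  obtain ⟨ψ, hψ, h_eval⟩ : ∃ ψ ∈ Γ, alg2.eval v ψ = false := by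
    by_contra! h_true
    have h_mem := h v fun ψ hψ => Bool.eq_true_of_not_eq_false (h_true ψ hψ)
    exact Bool.false_ne_true (h_false.symm.trans h_mem)
  exact (Deriv.mem hψ).trans_singleton
    (deriv_of_eval_alg2_eq_false (hΓ ψ hψ) (fun n => (hv n).1) h_eval)
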